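/- arXiv:1402.6457 — 3 statements merged into one kernel-verified Lean document; each statement's English description precedes it below -/
import Mathlib

section
/- In a finite connected simple graph G with sink r, for every routing tree T and every shortest path tree T_SPT of G, COST(T) ≥ (Tx+Rx)·Σ_{v ≠ r} (des_{T_SPT}(v)+s(v))/q. -/
open Finset

variable {V : Type*} [Fintype V] [DecidableEq V]

/-- A routing tree for a network `G` with sink `r`: every vertex `v ≠ r` has a unique
parent adjacent to it in `G`, and iterating parents reaches `r`. -/
structure RoutingTree (G : SimpleGraph V) (r : V) where
  parent : V → V
  parent_root : parent r = r
  adj : ∀ v, v ≠ r → G.Adj v (parent v)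
  reaches : ∀ v, ∃ n, parent^[n] v = r

open scoped Classical in
/-- `des s T v`: the total size of reports of the proper descendants of `v` in `T`,
i.e. of the vertices `u ≠ v` whose tree path to the root passes through `v`. -/
noncomputable def des {G : SimpleGraph V} {r : V} (s : V → ℕ)
    (T : RoutingTree G r) (v : V) : ℕ :=
  ∑ u ∈ Finset.univ, if u ≠ v ∧ (∃ n, T.parent^[n] u = v) then s u else 0

/-- The energy cost of a routing tree:
`COST(T) = (Tx+Rx) · Σ_{v ≠ r} ⌈(des_T(v)+s(v))/q⌉`. -/
noncomputable def cost {G : SimpleGraph V} {r : V} (s : V → ℕ) (q : ℕ)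
    (Tx Rx : ℝ) (T : RoutingTree G r) : ℝ :=
  (Tx + Rx) * ∑ v ∈ Finset.univ.erase r, (⌈(((des s T v + s v : ℕ) : ℝ) / (q : ℝ))⌉ : ℝ)

/-- The hop distance from `v` to the root `r` in the routing tree `T`. -/
noncomputable def treeDist {G : SimpleGraph V} (r : V) (T : RoutingTree G r) (v : V) : ℕ :=
  sInf {n : ℕ | T.parent^[n] v = r}

/-- A shortest path tree: every vertex's hop distance to `r` in `T` equals its hop
distance to `r` in `G`. -/
def IsSPT {G : SimpleGraph V} (r : V) (T : RoutingTree G r) : Prop :=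
  ∀ v, treeDist r T v = G.dist v r

theorem parent_iterate_treeDist {G : SimpleGraph V} {r : V} (T : RoutingTree G r) (v : V) :
    T.parent^[treeDist r T v] v = r :=
  Nat.sInf_mem (s := {n : ℕ | T.parent^[n] v = r}) (T.reaches v)

theorem treeDist_le {G : SimpleGraph V} {r : V} (T : RoutingTree G r) {v : V} {n : ℕ}
    (h : T.parent^[n] v = r) : treeDist r T v ≤ n :=
  Nat.sInf_le h

theorem parent_iterate_root {G : SimpleGraph V} {r : V} (T : RoutingTree G r) (n : ℕ) :
    T.parent^[n] r = r :=
  Function.iterate_fixed T.parent_root n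

theorem dist_le_of_parent_iterate {G : SimpleGraph V} (hG : G.Connected) {r : V}
    (T : RoutingTree G r) (n : ℕ) (v : V) (h : T.parent^[n] v = r) : G.dist v r ≤ n := by
  induction n generalizing v with
  | zero =>
    obtain rfl : v = r := h
    simp
  | succ n ih =>
    by_cases hv : v = r
    · simp [hv]
    · have h₁ := ih (T.parent v) h
      have h₂ : G.dist v (T.parent v) = 1 := SimpleGraph.dist_eq_one_iff_adj.2 (T.adj v hv)
      have h₃ := hG.dist_triangle (u := v) (v := T.parent v) (w := r)
      lia

theorem dist_le_treeDist {G : SimpleGraph V} (hG : G.Connected) {r : V}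
    (T : RoutingTree G r) (v : V) : G.dist v r ≤ treeDist r T v :=
  dist_le_of_parent_iterate hG T _ v (parent_iterate_treeDist T v)

open scoped Classical in
/-- The non-root vertices on the tree path from `u` to the root are as many as the hops. -/
theorem card_ancestors_eq_treeDist {G : SimpleGraph V} {r : V} (T : RoutingTree G r) (u : V) :
    #{v ∈ Finset.univ.erase r | ∃ n, T.parent^[n] u = v} = treeDist r T u := by
  have himage : {v ∈ Finset.univ.erase r | ∃ n, T.parent^[n] u = v} =
      (Finset.range (treeDist r T u)).image (fun n ↦ T.parent^[n] u) := by
    ext v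
    simp only [mem_filter, mem_erase, mem_univ, and_true, mem_image, mem_range]
    constructor
    · rintro ⟨hv, n, rfl⟩
      refine ⟨n, ?_, rfl⟩
      by_contra! hle
      obtain ⟨k, rfl⟩ := Nat.exists_eq_add_of_le' hle
      rw [Function.iterate_add_apply, parent_iterate_treeDist, parent_iterate_root] at hv
      exact hv rfl
    · rintro ⟨n, hn, rfl⟩
      exact ⟨fun h ↦ (treeDist_le T h).not_gt hn, n, rfl⟩
  have hne : ∀ i j, i < j → j < treeDist r T u → T.parent^[i] u ≠ T.parent^[j] u := by
    intro i j hij hj h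
    have hr : T.parent^[treeDist r T u - j + i] u = r := by
      rw [Function.iterate_add_apply, h, ← Function.iterate_add_apply,
        Nat.sub_add_cancel hj.le, parent_iterate_treeDist]
    have := treeDist_le T hr
    lia
  rw [himage, card_image_of_injOn, card_range]
  intro i hi j hj hij
  simp only [coe_range, Set.mem_Iio] at hi hj
  rcases lt_trichotomy i j with h | h | h
  · exact absurd hij (hne i j h hj)
  · exact h
  · exact absurd hij.symm (hne j i h hi)

open scoped Classical in
theorem des_add_self {G : SimpleGraph V} {r : V} (s : V → ℕ) (T : RoutingTree G r) (v : V) :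
    des s T v + s v = ∑ u, if ∃ n, T.parent^[n] u = v then s u else 0 := by
  have hself : s v = ∑ u, if u = v then s u else 0 := by simp
  unfold des
  conv_lhs => rw [hself]
  rw [← sum_add_distrib]
  refine sum_congr rfl fun u _ ↦ ?_
  by_cases huv : u = v
  · have h : ∃ n, T.parent^[n] u = v := ⟨0, huv⟩
    simp only [huv] at h ⊢
    simp [h]
  · simp [huv]

theorem sum_des_add_self {G : SimpleGraph V} {r : V} (s : V → ℕ) (T : RoutingTree G r) :
    ∑ v ∈ Finset.univ.erase r, (des s T v + s v) = ∑ u, treeDist r T u * s u := by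
  classical
  simp_rw [des_add_self]
  rw [sum_comm]
  refine sum_congr rfl fun u _ ↦ ?_
  rw [← card_ancestors_eq_treeDist, ← sum_filter, sum_const, smul_eq_mul]

/-- For every routing tree `T` and every shortest path tree `T_SPT`,
`COST(T) ≥ (Tx+Rx) · Σ_{v ≠ r} (des_{T_SPT}(v)+s(v))/q`. -/
theorem cost_ge_spt_fractional_sum (G : SimpleGraph V) (hG : G.Connected) (r : V)
    (s : V → ℕ) (hs0 : s r = 0) (hs1 : ∀ v, v ≠ r → 1 ≤ s v)
    (q : ℕ) (hq : 1 ≤ q) (Tx Rx : ℝ) (hTx : 0 < Tx) (hRx : 0 < Rx)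
    (T : RoutingTree G r) (TSPT : RoutingTree G r) (hSPT : IsSPT r TSPT) :
    (Tx + Rx) * ∑ v ∈ Finset.univ.erase r, (((des s TSPT v + s v : ℕ) : ℝ) / (q : ℝ)) ≤
      cost s q Tx Rx T := by
  have hsum : ∑ v ∈ Finset.univ.erase r, (des s TSPT v + s v) ≤
      ∑ v ∈ Finset.univ.erase r, (des s T v + s v) := by
    rw [sum_des_add_self, sum_des_add_self]
    refine sum_le_sum fun u _ ↦ Nat.mul_le_mul_right _ ?_
    exact (hSPT u).trans_le (dist_le_treeDist hG T u)
  unfold cost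
  refine mul_le_mul_of_nonneg_left ?_ (add_pos hTx hRx).le
  calc ∑ v ∈ Finset.univ.erase r, (((des s TSPT v + s v : ℕ) : ℝ) / (q : ℝ))
      = ((∑ v ∈ Finset.univ.erase r, (des s TSPT v + s v) : ℕ) : ℝ) / q := by
        rw [Nat.cast_sum, sum_div]
    _ ≤ ((∑ v ∈ Finset.univ.erase r, (des s T v + s v) : ℕ) : ℝ) / q := by gcongr
    _ = ∑ v ∈ Finset.univ.erase r, (((des s T v + s v : ℕ) : ℝ) / (q : ℝ)) := by
        rw [Nat.cast_sum, sum_div]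
    _ ≤ _ := sum_le_sum fun v _ ↦ Int.le_ceil _
end

section
/- In a finite connected simple graph G with sink r and |V| ≥ 2, for every shortest path tree T_SPT and every routing tree T of G, COST(T_SPT) − COST(T) < (Tx+Rx)·(|V|−1). -/
open Finset

variable {V : Type*} [Fintype V] [DecidableEq V]

open scoped Classical in
/-- The non-root vertices on the tree path from `u` to the root, including `u` itself. -/
noncomputable def RoutingTree.pathVerts {G : SimpleGraph V} {r : V} (T : RoutingTree G r)
    (u : V) : Finset V :=
  (Finset.univ.erase r).filter fun v => ∃ n, T.parent^[n] u = v

lemma RoutingTree.mem_pathVerts {G : SimpleGraph V} {r : V} {T : RoutingTree G r} {u v : V} :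
    v ∈ T.pathVerts u ↔ v ≠ r ∧ ∃ n, T.parent^[n] u = v := by
  simp [RoutingTree.pathVerts]

lemma sum_des_add_eq {G : SimpleGraph V} {r : V} (s : V → ℕ) (T : RoutingTree G r) :
    ∑ v ∈ Finset.univ.erase r, (des s T v + s v) = ∑ u, s u * #(T.pathVerts u) := by
  classical
  have des_add (v : V) :
      des s T v + s v = ∑ u, if ∃ n, T.parent^[n] u = v then s u else 0 := by
    have hs : s v = ∑ u, if u = v then s u else 0 := by simp
    rw [des, hs, ← Finset.sum_add_distrib]
    refine Finset.sum_congr rfl fun u _ => ?_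
    by_cases huv : u = v
    · have : ∃ n, T.parent^[n] u = v := ⟨0, huv⟩
      simp [huv, huv ▸ this]
    · simp [huv]
  simp_rw [des_add]
  rw [Finset.sum_comm]
  refine Finset.sum_congr rfl fun u _ => ?_
  rw [← Finset.sum_filter, Finset.sum_const, smul_eq_mul, mul_comm, RoutingTree.pathVerts]

lemma RoutingTree.card_pathVerts_le_treeDist {G : SimpleGraph V} {r : V} (T : RoutingTree G r)
    (u : V) : #(T.pathVerts u) ≤ treeDist r T u := by
  have hroot : T.parent^[treeDist r T u] u = r := Nat.sInf_mem (T.reaches u)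
  have hsub : T.pathVerts u ⊆
      (Finset.range (treeDist r T u)).image fun n => T.parent^[n] u := by
    intro v hv
    obtain ⟨hvr, n, rfl⟩ := RoutingTree.mem_pathVerts.1 hv
    refine Finset.mem_image.2 ⟨n, Finset.mem_range.2 ?_, rfl⟩
    by_contra! hn
    refine hvr ?_
    rw [← Nat.sub_add_cancel hn, Function.iterate_add_apply, hroot]
    exact Function.iterate_fixed T.parent_root _
  simpa using (Finset.card_le_card hsub).trans Finset.card_image_le

lemma RoutingTree.dist_le_card_pathVerts {G : SimpleGraph V} (hG : G.Connected) {r : V}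
    (T : RoutingTree G r) (u : V) : G.dist u r ≤ #(T.pathVerts u) := by
  have hex (k : ℕ) (hk : 1 ≤ k) (n : ℕ) : ∀ u, T.parent^[n] u = r → k ≤ G.dist u r →
      ∃ v ∈ T.pathVerts u, G.dist v r = k := by
    induction n with
    | zero =>
      intro u hu h
      rw [Function.iterate_zero_apply] at hu
      subst hu
      simp at h
      omega
    | succ n ih =>
      intro u hu h
      have hur : u ≠ r := by
        rintro rfl
        simp at h
        omega
      rcases h.eq_or_lt with h | h
      · exact ⟨u, RoutingTree.mem_pathVerts.2 ⟨hur, 0, rfl⟩, h.symm⟩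
      · have htri := hG.dist_triangle (u := u) (v := T.parent u) (w := r)
        rw [SimpleGraph.dist_eq_one_iff_adj.2 (T.adj u hur)] at htri
        obtain ⟨v, hv, hvk⟩ := ih (T.parent u) hu (by omega)
        obtain ⟨hvr, m, hm⟩ := RoutingTree.mem_pathVerts.1 hv
        exact ⟨v, RoutingTree.mem_pathVerts.2 ⟨hvr, m + 1, hm⟩, hvk⟩
  obtain ⟨n, hn⟩ := T.reaches u
  have hsub : Finset.Icc 1 (G.dist u r) ⊆ (T.pathVerts u).image fun v => G.dist v r := by
    intro k hk
    obtain ⟨hk1, hk2⟩ := Finset.mem_Icc.1 hk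
    exact Finset.mem_image.2 (hex k hk1 n u hn hk2)
  simpa using (Finset.card_le_card hsub).trans Finset.card_image_le

/-- For every shortest path tree `T_SPT` and every routing tree `T` of a connected graph
with at least two vertices, `COST(T_SPT) − COST(T) < (Tx+Rx)·(|V|−1)`. -/
theorem spt_cost_sub_cost_lt (G : SimpleGraph V) (hG : G.Connected) (r : V)
    (s : V → ℕ) (hs0 : s r = 0) (hs1 : ∀ v, v ≠ r → 1 ≤ s v)
    (q : ℕ) (hq : 1 ≤ q) (Tx Rx : ℝ) (hTx : 0 < Tx) (hRx : 0 < Rx)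
    (hcard : 2 ≤ Fintype.card V)
    (TSPT : RoutingTree G r) (hSPT : IsSPT r TSPT) (T : RoutingTree G r) :
    cost s q Tx Rx TSPT - cost s q Tx Rx T < (Tx + Rx) * ((Fintype.card V : ℝ) - 1) := by
  have hload : ∑ v ∈ Finset.univ.erase r, (des s TSPT v + s v) ≤
      ∑ v ∈ Finset.univ.erase r, (des s T v + s v) := by
    rw [sum_des_add_eq, sum_des_add_eq]
    refine Finset.sum_le_sum fun u _ => Nat.mul_le_mul_left _ ?_
    exact ((TSPT.card_pathVerts_le_treeDist u).trans_eq (hSPT u)).trans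
      (T.dist_le_card_pathVerts hG u)
  have hcardErase : #(Finset.univ.erase r) = Fintype.card V - 1 := by
    rw [Finset.card_erase_of_mem (Finset.mem_univ r), Finset.card_univ]
  have hne : (Finset.univ.erase r).Nonempty := by
    rw [← Finset.card_pos]
    omega
  have hupper : ∑ v ∈ Finset.univ.erase r, (⌈((des s TSPT v + s v : ℕ) : ℝ) / (q : ℝ)⌉ : ℝ) <
      ∑ v ∈ Finset.univ.erase r, (((des s TSPT v + s v : ℕ) : ℝ) / (q : ℝ) + 1) :=
    Finset.sum_lt_sum_of_nonempty hne fun v _ => Int.ceil_lt_add_one _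
  have hlower : ∑ v ∈ Finset.univ.erase r, ((des s T v + s v : ℕ) : ℝ) / (q : ℝ) ≤
      ∑ v ∈ Finset.univ.erase r, (⌈((des s T v + s v : ℕ) : ℝ) / (q : ℝ)⌉ : ℝ) :=
    Finset.sum_le_sum fun v _ => Int.le_ceil _
  rw [Finset.sum_add_distrib, Finset.sum_const, nsmul_eq_mul, mul_one, hcardErase,
    Nat.cast_sub (by omega), Nat.cast_one, ← Finset.sum_div, ← Nat.cast_sum] at hupper
  rw [← Finset.sum_div, ← Nat.cast_sum] at hlower
  have hdiv : ((∑ v ∈ Finset.univ.erase r, (des s TSPT v + s v) : ℕ) : ℝ) / (q : ℝ) ≤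
      ((∑ v ∈ Finset.univ.erase r, (des s T v + s v) : ℕ) : ℝ) / (q : ℝ) := by
    gcongr
  rw [cost, cost, ← mul_sub]
  exact mul_lt_mul_of_pos_left (by linarith) (by linarith)
end

section
/- Let G be a finite connected simple graph with sink r, source set U ⊆ V∖{r}, demands s(u) ≥ 1 for u ∈ U (and s = 0 elsewhere), and capacity/aggregation ratio q ≥ 1, and give every edge of G length Tx+Rx with Tx, Rx > 0. For every routing tree with relay nodes T, the route R_T that assigns to each source u ∈ U its path to r in T satisfies COST_CND(R_T) = COST(T). Consequently, the minimum cost of a route in this Capacitated Network Design instance is at most the minimum energy cost of a routing tree with relay nodes. -/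
open Finset

variable {V : Type*} [Fintype V] [DecidableEq V]

/-- A routing tree with relay nodes for a network `G` with sink `r` and source set `U`:
a subtree of `G` rooted at `r` whose vertex set contains `U ∪ {r}`. Every vertex `v ≠ r`
of the tree has a unique parent adjacent to it in `G`, and iterating parents reaches `r`. -/
structure RelayTree (G : SimpleGraph V) (r : V) (U : Finset V) where
  verts : Finset V
  root_mem : r ∈ verts
  source_subset : U ⊆ verts
  parent : V → V
  parent_mem : ∀ v ∈ verts, parent v ∈ verts
  parent_root : parent r = r
  adj : ∀ v ∈ verts, v ≠ r → G.Adj v (parent v)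
  reaches : ∀ v ∈ verts, ∃ n, parent^[n] v = r

open scoped Classical in
/-- `desR s T v`: the total size of reports of the proper descendants of `v` in `T`,
i.e. of the vertices `u ≠ v` of `T` whose tree path to the root passes through `v`. -/
noncomputable def desR {G : SimpleGraph V} {r : V} {U : Finset V} (s : V → ℕ)
    (T : RelayTree G r U) (v : V) : ℕ :=
  ∑ u ∈ T.verts, if u ≠ v ∧ (∃ n, T.parent^[n] u = v) then s u else 0

/-- The energy cost of a routing tree with relay nodes:
`COST(T) = (Tx+Rx) · Σ_{v ∈ V(T), v ≠ r} ⌈(des_T(v)+s(v))/q⌉`. -/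
noncomputable def costR {G : SimpleGraph V} {r : V} {U : Finset V} (s : V → ℕ) (q : ℕ)
    (Tx Rx : ℝ) (T : RelayTree G r U) : ℝ :=
  (Tx + Rx) * ∑ v ∈ T.verts.erase r, (⌈(((desR s T v + s v : ℕ) : ℝ) / (q : ℝ))⌉ : ℝ)

/-- The hop distance from `v` to the root `r` in the tree `T`. -/
noncomputable def relayDist {G : SimpleGraph V} {r : V} {U : Finset V}
    (T : RelayTree G r U) (v : V) : ℕ :=
  sInf {n : ℕ | T.parent^[n] v = r}

/-- The minimum number of edges of a connected subgraph of `G` containing `U ∪ {r}`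
(the number of edges of a minimum Steiner tree for `U ∪ {r}`). -/
noncomputable def steinerEdges (G : SimpleGraph V) (U : Finset V) (r : V) : ℕ :=
  sInf {k : ℕ | ∃ H : G.Subgraph, H.Connected ∧ (↑U ∪ {r} : Set V) ⊆ H.verts ∧
    H.edgeSet.ncard = k}

/-- A route for the Capacitated Network Design problem: a choice, for each source `u ∈ U`,
of a path `P_u` from `u` to the sink `r` in `G`. -/
def Route (G : SimpleGraph V) (U : Finset V) (r : V) : Type _ :=
  ∀ u : {x // x ∈ U}, G.Path u.1 r

/-- `E(R)`: the set of edges used by at least one path of the route `R`. -/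
def routeEdges {G : SimpleGraph V} {U : Finset V} {r : V} (R : Route G U r) :
    Finset (Sym2 V) :=
  U.attach.biUnion fun u => ((R u : G.Walk u.1 r).edges).toFinset

open scoped Classical in
/-- `z(e) = (Σ_{u : e ∈ P_u} s(u))/q`: the total demand routed through `e`, divided by the
capacity `q`. -/
noncomputable def zval {G : SimpleGraph V} {U : Finset V} {r : V}
    (s : V → ℕ) (q : ℕ) (R : Route G U r) (e : Sym2 V) : ℝ :=
  (∑ u ∈ U.attach, if e ∈ (R u : G.Walk u.1 r).edges then (s u.1 : ℝ) else 0) / (q : ℝ)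

/-- `COST_CND(R) = Σ_{e ∈ E(R)} ⌈z(e)⌉·w(e)`: the cost of installing the facilities of the
route `R`, where `w e` is the length of the edge `e`. -/
noncomputable def costCND {G : SimpleGraph V} {U : Finset V} {r : V}
    (s : V → ℕ) (q : ℕ) (w : Sym2 V → ℝ) (R : Route G U r) : ℝ :=
  ∑ e ∈ routeEdges R, (⌈zval s q R e⌉ : ℝ) * w e

/-- `l(p)`: the total length of a walk `p` with respect to edge lengths `w`. -/
noncomputable def walkLen (w : Sym2 V → ℝ) {G : SimpleGraph V} {a b : V}
    (p : G.Walk a b) : ℝ :=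
  (p.edges.map w).sum

/-- `dist_G(a,b)`: the minimum total length of an `a`–`b` path in `G`. -/
noncomputable def wdist (G : SimpleGraph V) (w : Sym2 V → ℝ) (a b : V) : ℝ :=
  sInf {x : ℝ | ∃ p : G.Walk a b, p.IsPath ∧ walkLen w p = x}

/-- The minimum total edge length of a connected subgraph of `G` containing `U ∪ {r}`
(a minimum Steiner tree for `U ∪ {r}`). -/
noncomputable def steinerWeight (G : SimpleGraph V) (w : Sym2 V → ℝ)
    (U : Finset V) (r : V) : ℝ :=
  sInf {x : ℝ | ∃ H : G.Subgraph, H.Connected ∧ (↑U ∪ {r} : Set V) ⊆ H.verts ∧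
    ∑ e ∈ H.edgeSet.toFinite.toFinset, w e = x}


/-- The set of vertices used by at least one path of the route `R`. -/
def routeVerts {G : SimpleGraph V} {U : Finset V} {r : V} (R : Route G U r) :
    Finset V :=
  U.attach.biUnion fun u => ((R u : G.Walk u.1 r).support).toFinset

/-- The graph `G''` consisting of all vertices and edges used by the route `R`. -/
def routeGraph {G : SimpleGraph V} {U : Finset V} {r : V} (R : Route G U r) :
    SimpleGraph V :=
  SimpleGraph.fromEdgeSet (↑(routeEdges R) : Set (Sym2 V))

namespace RelayTree

variable {G : SimpleGraph V} {r : V} {U : Finset V} (T : RelayTree G r U)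

lemma iterate_parent_mem {v : V} (hv : v ∈ T.verts) (n : ℕ) : T.parent^[n] v ∈ T.verts := by
  induction n with
  | zero => exact hv
  | succ n ih => rw [Function.iterate_succ_apply']; exact T.parent_mem _ ih

lemma iterate_parent_root (n : ℕ) : T.parent^[n] r = r :=
  Function.iterate_fixed T.parent_root n

lemma iterate_parent_relayDist {v : V} (hv : v ∈ T.verts) :
    T.parent^[relayDist T v] v = r :=
  Nat.sInf_mem (s := {n : ℕ | T.parent^[n] v = r}) (T.reaches v hv)

lemma iterate_parent_ne_root {v : V} {m : ℕ} (hm : m < relayDist T v) :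
    T.parent^[m] v ≠ r :=
  fun h => Nat.notMem_of_lt_sInf hm h

lemma iterate_parent_eq_root {v : V} (hv : v ∈ T.verts) {m : ℕ} (hm : relayDist T v ≤ m) :
    T.parent^[m] v = r := by
  obtain ⟨k, rfl⟩ := Nat.exists_eq_add_of_le' hm
  rw [Function.iterate_add_apply, T.iterate_parent_relayDist hv, T.iterate_parent_root]

lemma iterate_parent_ne {v : V} (hv : v ∈ T.verts) {i j : ℕ} (hij : i < j)
    (hj : j ≤ relayDist T v) : T.parent^[i] v ≠ T.parent^[j] v := by
  intro h
  refine T.iterate_parent_ne_root (v := v) (m := relayDist T v - j + i) (by omega) ?_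
  rw [Function.iterate_add_apply, h, ← Function.iterate_add_apply, Nat.sub_add_cancel hj,
    T.iterate_parent_relayDist hv]

/-- A non-root vertex of the tree does not lie on a 2-cycle of `parent`, so it is determined by
the edge to its parent. -/
lemma injOn_parentEdge :
    Set.InjOn (fun v => s(v, T.parent v)) (T.verts.erase r : Finset V) := by
  intro v hv w hw h
  simp only [coe_erase, Set.mem_sdiff, mem_coe, Set.mem_singleton_iff] at hv hw
  rcases Sym2.eq_iff.1 h with h | ⟨h₁, h₂⟩
  · exact h.1
  · exfalso
    have hper : ∀ n, T.parent^[n] v = v ∨ T.parent^[n] v = w := by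
      intro n
      induction n with
      | zero => exact Or.inl rfl
      | succ n ih =>
        rw [Function.iterate_succ_apply']
        rcases ih with ih | ih
        · exact Or.inr (by rw [ih, h₂])
        · exact Or.inl (by rw [ih, ← h₁])
    obtain ⟨n, hn⟩ := T.reaches v hv.1
    rcases hper n with h | h
    · exact hv.2 (h ▸ hn)
    · exact hw.2 (h ▸ hn)

lemma exists_walk (n : ℕ) (v : V) (hv : v ∈ T.verts) (hn : T.parent^[n] v = r)
    (hlt : ∀ m < n, T.parent^[m] v ≠ r) :
    ∃ p : G.Walk v r, p.support = (List.range (n + 1)).map (fun i => T.parent^[i] v) ∧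
      p.edges = (List.range n).map
        (fun i => s(T.parent^[i] v, T.parent (T.parent^[i] v))) := by
  induction n generalizing v with
  | zero =>
    obtain rfl : v = r := hn
    exact ⟨.nil, by simp, by simp⟩
  | succ n ih =>
    obtain ⟨p, hp, hp'⟩ := ih (T.parent v) (T.parent_mem v hv) hn
      (fun m hm => hlt (m + 1) (by omega))
    refine ⟨.cons (T.adj v hv (hlt 0 (by omega))) p, ?_, ?_⟩
    · rw [SimpleGraph.Walk.support_cons, hp, List.range_succ_eq_map (n := n + 1)]
      simp [Function.comp_def]
    · rw [SimpleGraph.Walk.edges_cons, hp', List.range_succ_eq_map]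
      simp [Function.comp_def]

/-- The tree path from a vertex to the root. -/
lemma exists_path {v : V} (hv : v ∈ T.verts) :
    ∃ p : G.Path v r,
      (p : G.Walk v r).support =
        (List.range (relayDist T v + 1)).map (fun i => T.parent^[i] v) ∧
      (p : G.Walk v r).edges = (List.range (relayDist T v)).map
        (fun i => s(T.parent^[i] v, T.parent (T.parent^[i] v))) := by
  obtain ⟨p, hp, hp'⟩ := T.exists_walk _ v hv (T.iterate_parent_relayDist hv)
    (fun _ hm => T.iterate_parent_ne_root hm)
  refine ⟨⟨p, ?_⟩, hp, hp'⟩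
  rw [SimpleGraph.Walk.isPath_def, hp]
  refine List.Nodup.map_on ?_ List.nodup_range
  intro i hi j hj h
  rw [List.mem_range] at hi hj
  by_contra hne
  rcases Nat.lt_or_gt_of_ne hne with hlt | hlt
  · exact T.iterate_parent_ne hv hlt (by omega) h
  · exact T.iterate_parent_ne hv hlt (by omega) h.symm

lemma parentEdge_mem_iff {u v : V} (hu : u ∈ T.verts) (hv : v ∈ T.verts.erase r) :
    s(v, T.parent v) ∈ (List.range (relayDist T u)).map
        (fun i => s(T.parent^[i] u, T.parent (T.parent^[i] u))) ↔
      ∃ n, T.parent^[n] u = v := by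
  simp only [List.mem_map, List.mem_range]
  constructor
  · rintro ⟨i, hi, h⟩
    exact ⟨i, T.injOn_parentEdge
      (mem_coe.2 (mem_erase.2 ⟨T.iterate_parent_ne_root hi, T.iterate_parent_mem hu i⟩))
      (mem_coe.2 hv) h⟩
  · rintro ⟨n, rfl⟩
    refine ⟨n, ?_, rfl⟩
    by_contra hn
    exact (mem_erase.1 hv).1 (T.iterate_parent_eq_root hu (not_lt.1 hn))

open scoped Classical in
lemma desR_add_self (s : V → ℕ) (hs0 : ∀ v, v ∉ U → s v = 0) {v : V} (hv : v ∈ T.verts) :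
    desR s T v + s v = ∑ u ∈ U, if ∃ n, T.parent^[n] u = v then s u else 0 := by
  have hsub : ∑ u ∈ U, (if ∃ n, T.parent^[n] u = v then s u else 0) =
      ∑ u ∈ T.verts, if ∃ n, T.parent^[n] u = v then s u else 0 :=
    sum_subset T.source_subset fun u _ hu => by simp [hs0 u hu]
  have hself : s v = ∑ u ∈ T.verts, if u = v then s u else 0 := by simp [hv]
  rw [hsub, desR, hself, ← sum_add_distrib]
  refine sum_congr rfl fun u _ => ?_
  by_cases huv : u = v
  · simp [huv, show ∃ n, T.parent^[n] v = v from ⟨0, rfl⟩]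
  · simp [huv]

end RelayTree

lemma zval_eq_zero_of_notMem {G : SimpleGraph V} {U : Finset V} {r : V} (s : V → ℕ) (q : ℕ)
    (R : Route G U r) {e : Sym2 V} (he : e ∉ routeEdges R) : zval s q R e = 0 := by
  simp only [routeEdges, mem_biUnion, mem_attach, true_and, List.mem_toFinset,
    not_exists] at he
  simp [zval, he]

/-- For every routing tree with relay nodes `T` there is a route `R_T` assigning to each
source `u ∈ U` its tree path to `r` in `T` (the path `u, parent u, parent² u, …, r`), and
this route satisfies `COST_CND(R_T) = COST(T)` when every edge of `G` has length `Tx+Rx`.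
Consequently, the minimum cost of a route of this CND instance is at most the minimum
energy cost of a routing tree with relay nodes. -/
theorem tree_route_costCND_eq_costR (G : SimpleGraph V) (hG : G.Connected)
    (r : V) (U : Finset V) (hr : r ∉ U)
    (s : V → ℕ) (hsU : ∀ u ∈ U, 1 ≤ s u) (hs0 : ∀ v, v ∉ U → s v = 0)
    (q : ℕ) (hq : 1 ≤ q) (Tx Rx : ℝ) (hTx : 0 < Tx) (hRx : 0 < Rx)
    (T : RelayTree G r U) :
    ∃ R : Route G U r,
      (∀ u : {x // x ∈ U},
        (R u : G.Walk u.1 r).support =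
          (List.range (relayDist T u.1 + 1)).map (fun n => T.parent^[n] u.1)) ∧
      costCND s q (fun _ => Tx + Rx) R = costR s q Tx Rx T := by
  obtain ⟨R, hR⟩ : ∃ R : Route G U r, ∀ u : {x // x ∈ U}, _ :=
    Classical.axiomOfChoice fun u : {x // x ∈ U} => T.exists_path (T.source_subset u.2)
  have hsupp := fun u => (hR u).1
  have hedges := fun u => (hR u).2
  refine ⟨R, hsupp, ?_⟩
  have hsub : routeEdges R ⊆ (T.verts.erase r).image (fun v => s(v, T.parent v)) := by
    intro e he
    simp only [routeEdges, mem_biUnion, mem_attach, true_and, List.mem_toFinset] at he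
    obtain ⟨u, hu⟩ := he
    rw [hedges, List.mem_map] at hu
    obtain ⟨i, hi, rfl⟩ := hu
    exact mem_image_of_mem _ (mem_erase.2 ⟨T.iterate_parent_ne_root (List.mem_range.1 hi),
      T.iterate_parent_mem (T.source_subset u.2) i⟩)
  have hz : ∀ v ∈ T.verts.erase r,
      zval s q R s(v, T.parent v) = ((desR s T v + s v : ℕ) : ℝ) / (q : ℝ) := by
    classical
    intro v hv
    rw [T.desR_add_self s hs0 (mem_of_mem_erase hv), zval, ← sum_attach U]
    push_cast
    congr 1
    refine sum_congr rfl fun u _ => ?_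
    rw [hedges]
    exact if_congr (T.parentEdge_mem_iff (T.source_subset u.2) hv) rfl rfl
  calc costCND s q (fun _ => Tx + Rx) R
      = ∑ e ∈ (T.verts.erase r).image (fun v => s(v, T.parent v)),
          (⌈zval s q R e⌉ : ℝ) * (Tx + Rx) :=
        sum_subset hsub fun e _ he => by simp [zval_eq_zero_of_notMem s q R he]
    _ = ∑ v ∈ T.verts.erase r, (⌈zval s q R s(v, T.parent v)⌉ : ℝ) * (Tx + Rx) :=
        sum_image T.injOn_parentEdge
    _ = costR s q Tx Rx T := by
        rw [costR, mul_sum]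
        exact sum_congr rfl fun v hv => by rw [hz v hv, mul_comm]
end
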